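/- Let N ≥ 3 and let B_N be the open unit ball of ℝ^N. For every t ∈ B_N with t ≠ 0, the function k_t(x) := γ_{|t|,N}(|x|) belongs to W^{1,2}_{0,r}(B_N) and is the reproducing kernel for the point t: for every v ∈ W^{1,2}_{0,r}(B_N), if u ∈ H_N is the locally absolutely continuous radial representative of v (so v(x) = u(|x|) a.e.), then ∫_{B_N} ∇k_t(x) · ∇v(x) dx = u(|t|). In particular the evaluation functional v ↦ u(|t|) is a bounded linear functional on W^{1,2}_{0,r}(B_N). -/

import Mathlib

open MeasureTheory Set Filter RealInnerProductSpace

/-- `ω_{N-1}`, the surface measure of the unit sphere `S^{N-1} ⊆ ℝᴺ`,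
via the formula `|S^{N-1}| = N·|B^N|`. -/
noncomputable def omegaS (N : ℕ) : ℝ :=
  N * (volume (Metric.ball (0 : EuclideanSpace ℝ (Fin N)) 1)).toReal

/-- Membership in the space `H_N`: `u : (0,1] → ℝ` is locally absolutely continuous on `(0,1]`
(equivalently, its a.e. pointwise derivative `deriv u` is integrable on every `[a,1] ⊆ (0,1]`
and the fundamental theorem of calculus holds), `u 1 = 0`, and `∫_0^1 u'(r)² r^{N-1} dr < ∞`. -/
structure MemHN (N : ℕ) (u : ℝ → ℝ) : Prop where
  locInt : ∀ a ∈ Ioo (0:ℝ) 1, IntegrableOn (deriv u) (Ioc a 1) volume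
  ftc : ∀ x ∈ Ioc (0:ℝ) 1, u x = u 1 - ∫ s in Ioc x 1, deriv u s
  zero_at_one : u 1 = 0
  deriv_sq_int : IntegrableOn (fun r => (deriv u r)^2 * r^(N-1)) (Ioc (0:ℝ) 1) volume

/-- The `H_N` inner product `⟨u,v⟩_N = ω_{N-1} ∫_0^1 u'(r) v'(r) r^{N-1} dr`. -/
noncomputable def innerHN (N : ℕ) (u v : ℝ → ℝ) : ℝ :=
  omegaS N * ∫ r in Ioc (0:ℝ) 1, deriv u r * deriv v r * r^(N-1)

/-- The Trudinger–Moser type function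
`γ_{t,N}(r) = (1/((N-2)ω_{N-1})) min{r^{2-N} - 1, t^{2-N} - 1}`. -/
noncomputable def gammaTMN (N : ℕ) (t r : ℝ) : ℝ :=
  (1 / (((N:ℝ) - 2) * omegaS N)) *
    min (r ^ ((2:ℤ) - (N:ℤ)) - 1) (t ^ ((2:ℤ) - (N:ℤ)) - 1)

/-- Euclidean space `ℝⁿ`. -/
abbrev E (n : ℕ) := EuclideanSpace ℝ (Fin n)

/-- A compactly supported smooth function on the open unit ball `B_n`. -/
def IsTestFun (n : ℕ) (φ : E n → ℝ) : Prop :=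
  ContDiff ℝ (⊤ : ℕ∞) φ ∧ HasCompactSupport φ ∧ tsupport φ ⊆ Metric.ball 0 1

/-- A radially symmetric function on `ℝⁿ`. -/
def IsRadial (n : ℕ) (φ : E n → ℝ) : Prop :=
  ∀ x y : E n, ‖x‖ = ‖y‖ → φ x = φ y

/-- `v` represents an element of `W^{1,2}_{0,r}(B_n)` (the completion of the compactly
supported smooth radially symmetric functions on the unit ball under `‖∇·‖_{L²}`)
with weak gradient `G`: some sequence of compactly supported smooth radial functions
converges to `v` with gradients converging to `G` in `L²(B_n)`. -/
def MemW (n : ℕ) (v : E n → ℝ) (G : E n → E n) : Prop :=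
  ∃ φ : ℕ → E n → ℝ,
    (∀ k, IsTestFun n (φ k) ∧ IsRadial n (φ k)) ∧
    (∀ k, IntegrableOn (fun x => ‖gradient (φ k) x - G x‖^2) (Metric.ball (0 : E n) 1) volume) ∧
    (∀ k, IntegrableOn (fun x => (φ k x - v x)^2) (Metric.ball (0 : E n) 1) volume) ∧
    Tendsto (fun k => ∫ x in Metric.ball (0 : E n) 1, ‖gradient (φ k) x - G x‖^2) atTop (nhds 0) ∧
    Tendsto (fun k => ∫ x in Metric.ball (0 : E n) 1, (φ k x - v x)^2) atTop (nhds 0)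

theorem integrable_and_integral_le_of_sq {α : Type*} [MeasurableSpace α] {μ : Measure α}
    [IsFiniteMeasure μ] {D : α → ℝ} (h0 : ∀ x, 0 ≤ D x) (hD : Integrable (fun x => D x ^ 2) μ) :
    Integrable D μ ∧ ∫ x, D x ∂μ ≤ √(μ.real univ) * √(∫ x, D x ^ 2 ∂μ) := by
  have hm : AEStronglyMeasurable D μ := by
    have := Real.continuous_sqrt.comp_aestronglyMeasurable hD.1
    refine this.congr (Eventually.of_forall fun x => ?_)
    simp [Real.sqrt_sq (h0 x)]
  have hL : MemLp D 2 μ := (memLp_two_iff_integrable_sq hm).2 hD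
  refine ⟨hL.integrable one_le_two, ?_⟩
  have h := integral_mul_norm_le_Lp_mul_Lq (μ := μ) (f := fun _ : α => (1 : ℝ)) (g := D)
    Real.HolderConjugate.two_two (memLp_const 1) (by simpa using hL)
  simp only [Real.norm_eq_abs, abs_one, one_mul, abs_of_nonneg (h0 _)] at h
  simpa [Real.sqrt_eq_rpow] using h

theorem exists_seq_tendsto_ae_of_integral_tendsto_zero {α : Type*} [MeasurableSpace α]
    {μ : Measure α} {f : ℕ → α → ℝ} (h0 : ∀ k x, 0 ≤ f k x) (hf : ∀ k, Integrable (f k) μ)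
    (hlim : Tendsto (fun k => ∫ x, f k x ∂μ) atTop (nhds 0)) :
    ∃ ns : ℕ → ℕ, StrictMono ns ∧
      ∀ᵐ x ∂μ, Tendsto (fun k => f (ns k) x) atTop (nhds 0) := by
  have h : Tendsto (fun k => eLpNorm (f k - 0) 1 μ) atTop (nhds 0) := by
    have h1 := ENNReal.tendsto_ofReal hlim
    rw [ENNReal.ofReal_zero] at h1
    refine h1.congr fun k => ?_
    rw [sub_zero, eLpNorm_one_eq_lintegral_enorm, ofReal_integral_eq_lintegral_ofReal (hf k)
      (Eventually.of_forall (h0 k))]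
    simp [Real.enorm_eq_ofReal (h0 k _)]
  exact (tendstoInMeasure_of_tendsto_eLpNorm one_ne_zero (fun k => (hf k).1)
    aestronglyMeasurable_const h).exists_seq_tendsto_ae

theorem omegaS_pos {N : ℕ} (hN : 3 ≤ N) : 0 < omegaS N := by
  unfold omegaS
  have : 0 < volume (Metric.ball (0 : EuclideanSpace ℝ (Fin N)) 1) :=
    Metric.measure_ball_pos _ _ one_pos
  have h2 := ENNReal.toReal_pos this.ne' measure_ball_lt_top.ne
  have : (0 : ℝ) < N := by positivity
  positivity

/-- The radial field `-(1/ω_{N-1}) 1_{r < ‖y‖} ‖y‖^{-N} y`, the a.e. gradient of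
`gammaTMN N r ‖·‖` on the unit ball. -/
noncomputable def kernelGrad (N : ℕ) (r : ℝ) (y : E N) : E N :=
  (if r < ‖y‖ then -(1 / omegaS N) * (‖y‖ ^ N)⁻¹ else 0) • y

theorem measurable_kernelGrad (N : ℕ) (r : ℝ) : Measurable (kernelGrad N r) := by
  unfold kernelGrad
  have h : Measurable fun y : E N =>
      if r < ‖y‖ then -(1 / omegaS N) * (‖y‖ ^ N)⁻¹ else 0 :=
    Measurable.ite (measurableSet_lt measurable_const measurable_norm) (by fun_prop)
      measurable_const
  exact h.smul measurable_id

theorem norm_kernelGrad_le {N : ℕ} (hN : 3 ≤ N) {a r : ℝ} (ha : 0 < a) (har : a ≤ r) {y : E N}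
    (hy : ‖y‖ < 1) : ‖kernelGrad N r y‖ ≤ 1 / omegaS N * (a ^ N)⁻¹ := by
  have hω := omegaS_pos hN
  unfold kernelGrad
  split_ifs with h
  · rw [norm_smul, norm_mul, norm_neg, Real.norm_of_nonneg (by positivity),
      Real.norm_of_nonneg (by positivity)]
    have h1 : (‖y‖ ^ N)⁻¹ ≤ (a ^ N)⁻¹ := by
      have : a ≤ ‖y‖ := by linarith
      gcongr
    calc 1 / omegaS N * (‖y‖ ^ N)⁻¹ * ‖y‖ ≤ 1 / omegaS N * (a ^ N)⁻¹ * 1 := by gcongr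
      _ = _ := mul_one _
  · rw [zero_smul, norm_zero]; positivity

theorem gammaTMN_eq_max {N : ℕ} (hN : 3 ≤ N) {t r : ℝ} (ht : 0 < t) (hr : 0 < r) :
    gammaTMN N t r = 1 / (((N : ℝ) - 2) * omegaS N) * (max r t ^ ((2 : ℤ) - N) - 1) := by
  have hz : ∀ {a b : ℝ}, 0 < a → a ≤ b → b ^ ((2 : ℤ) - N) ≤ a ^ ((2 : ℤ) - N) := by
    intro a b ha hab
    have h2 : (2 : ℤ) - N = -((N - 2 : ℕ) : ℤ) := by omega
    rw [h2, zpow_neg, zpow_neg, zpow_natCast, zpow_natCast]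
    gcongr
  unfold gammaTMN
  rcases le_total r t with h | h
  · rw [max_eq_right h, min_eq_right (by linarith [hz hr h])]
  · rw [max_eq_left h, min_eq_left (by linarith [hz ht h])]

theorem deriv_gammaTMN_of_lt {N : ℕ} (hN : 3 ≤ N) {t r : ℝ} (hr : 0 < r) (h : r < t) :
    deriv (gammaTMN N t) r = 0 := by
  have ht : 0 < t := hr.trans h
  have : gammaTMN N t =ᶠ[nhds r]
      fun _ => 1 / (((N : ℝ) - 2) * omegaS N) * (t ^ ((2 : ℤ) - N) - 1) := by
    filter_upwards [Ioo_mem_nhds hr h] with s hs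
    rw [gammaTMN_eq_max hN ht hs.1, max_eq_right hs.2.le]
  rw [this.deriv_eq, deriv_const]

theorem deriv_gammaTMN_of_gt {N : ℕ} (hN : 3 ≤ N) {t r : ℝ} (ht : 0 < t) (h : t < r) :
    deriv (gammaTMN N t) r = -(1 / omegaS N) * (r ^ N)⁻¹ * r := by
  have hr : 0 < r := ht.trans h
  have hω := omegaS_pos hN
  have hN' : (N : ℝ) - 2 ≠ 0 := by
    have : (3 : ℝ) ≤ N := by exact_mod_cast hN
    linarith
  have : gammaTMN N t =ᶠ[nhds r]
      fun r => 1 / (((N : ℝ) - 2) * omegaS N) * (r ^ ((2 : ℤ) - N) - 1) := by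
    filter_upwards [Ioi_mem_nhds h] with s hs
    rw [gammaTMN_eq_max hN ht (ht.trans hs), max_eq_left (le_of_lt hs)]
  have hd := ((hasDerivAt_zpow ((2 : ℤ) - N) r (Or.inl hr.ne')).sub_const 1).const_mul
    (1 / (((N : ℝ) - 2) * omegaS N))
  rw [this.deriv_eq, hd.deriv, show (2 : ℤ) - N - 1 = 1 + -(N : ℤ) by ring,
    zpow_add₀ hr.ne', zpow_neg, zpow_natCast, zpow_one]
  push_cast
  field_simp
  ring

theorem ae_norm_ne (N : ℕ) [NeZero N] (r : ℝ) : ∀ᵐ x : E N, ‖x‖ ≠ r := by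
  have : Nontrivial (E N) := inferInstance
  have h := Measure.addHaar_sphere (volume : Measure (E N)) 0 r
  rw [ae_iff]
  simpa [Metric.sphere] using h

theorem gradient_gamma_ae_eq {N : ℕ} (hN : 3 ≤ N) {t : ℝ} (ht : 0 < t) :
    ∀ᵐ x : E N, (deriv (gammaTMN N t) ‖x‖ / ‖x‖) • x = kernelGrad N t x := by
  have : NeZero N := ⟨by omega⟩
  filter_upwards [ae_norm_ne N t, ae_norm_ne N 0] with x hx hx0
  have hpos : 0 < ‖x‖ := lt_of_le_of_ne (norm_nonneg _) (Ne.symm hx0)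
  unfold kernelGrad
  congr 1
  rcases lt_or_gt_of_ne hx with h | h
  · rw [deriv_gammaTMN_of_lt hN hpos h, if_neg h.not_gt, zero_div]
  · rw [deriv_gammaTMN_of_gt hN ht h, if_pos h, mul_div_cancel_right₀ _ hx0]

theorem integral_kernelGrad_inner_gradient {N : ℕ} (hN : 3 ≤ N) {φ : E N → ℝ}
    (hφ : IsTestFun N φ) (hrad : IsRadial N φ) {x : E N} (hx0 : x ≠ 0) (hx : ‖x‖ < 1) :
    ∫ y in Metric.ball (0 : E N) 1, ⟪kernelGrad N ‖x‖ y, gradient φ y⟫ = φ x := by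
  have hω := omegaS_pos hN
  have hxp : 0 < ‖x‖ := norm_pos_iff.2 hx0
  set e : E N := ‖x‖⁻¹ • x with he
  have hen : ‖e‖ = 1 := by rw [he, norm_smul, norm_inv, norm_norm, inv_mul_cancel₀ hxp.ne']
  set f : ℝ → ℝ := fun r => φ (r • e) with hf
  have hfs : ContDiff ℝ (⊤ : ℕ∞) f := hφ.1.comp (contDiff_id.smul contDiff_const)
  have hfd : Differentiable ℝ f := (contDiff_infty_iff_deriv.1 hfs).1
  have hfc : Continuous (deriv f) := (contDiff_infty_iff_deriv.1 hfs).2.continuous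
  have hφd : Differentiable ℝ φ := hφ.1.differentiable (by simp)
  have hrd : ∀ y : E N, ⟪y, gradient φ y⟫ = ‖y‖ * deriv f ‖y‖ := by
    intro y
    rw [real_inner_comm, inner_gradient_left]
    have h1 : HasDerivAt (fun s : ℝ => φ (s • y)) (fderiv ℝ φ y y) 1 := by
      have ha : HasDerivAt (fun s : ℝ => s • y) y 1 := by
        simpa using (hasDerivAt_id (1 : ℝ)).smul_const y
      have hb : HasFDerivAt φ (fderiv ℝ φ y) ((1 : ℝ) • y) := by
        rw [one_smul]; exact (hφd y).hasFDerivAt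
      exact hb.comp_hasDerivAt 1 ha
    have h2 : HasDerivAt (fun s : ℝ => f (s * ‖y‖)) (deriv f ‖y‖ * ‖y‖) 1 := by
      have ha : HasDerivAt (fun s : ℝ => s * ‖y‖) ‖y‖ 1 := by
        simpa using (hasDerivAt_id (1 : ℝ)).mul_const ‖y‖
      have hb : HasDerivAt f (deriv f ‖y‖) (1 * ‖y‖) := by
        rw [one_mul]; exact (hfd _).hasDerivAt
      exact hb.comp 1 ha
    have h3 : (fun s : ℝ => φ (s • y)) = fun s : ℝ => f (s * ‖y‖) := by
      funext s
      exact hrad _ _ (by simp [norm_smul, hen])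
    rw [h3] at h1
    rw [h1.unique h2, mul_comm]
  have hf1 : f 1 = 0 := by
    by_contra h
    have : (1 : ℝ) • e ∈ Metric.ball (0 : E N) 1 := hφ.2.2 (subset_tsupport _ h)
    simp [hen] at this
  have hfx : f ‖x‖ = φ x := by simp [hf, he, smul_smul, mul_inv_cancel₀ hxp.ne']
  set F : ℝ → ℝ := (Ioo ‖x‖ 1).indicator
    fun r => -(1 / omegaS N) * (r ^ N)⁻¹ * (r * deriv f r) with hF
  have hpolar : ∫ y in Metric.ball (0 : E N) 1, ⟪kernelGrad N ‖x‖ y, gradient φ y⟫ =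
      ∫ y : E N, F ‖y‖ := by
    rw [← integral_indicator Metric.isOpen_ball.measurableSet]
    congr 1
    funext y
    simp only [indicator, Metric.mem_ball, dist_zero_right, kernelGrad, hF, mem_Ioo, inner_smul_left,
      hrd]
    by_cases h1 : ‖y‖ < 1 <;> by_cases h2 : ‖x‖ < ‖y‖ <;> simp [h1, h2]
  have : Nontrivial (E N) := by
    have : NeZero N := ⟨by omega⟩
    infer_instance
  rw [hpolar, integral_fun_norm_addHaar volume F, finrank_euclideanSpace_fin]
  have h4 : ∫ r in Ioi (0 : ℝ), r ^ (N - 1) • F r = ∫ r in ‖x‖..1, -(1 / omegaS N) * deriv f r := by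
    rw [intervalIntegral.integral_of_le hx.le, integral_Ioc_eq_integral_Ioo,
      ← integral_indicator measurableSet_Ioi, ← integral_indicator measurableSet_Ioo]
    congr 1
    funext r
    simp only [indicator, hF, mem_Ioo, mem_Ioi, smul_eq_mul]
    by_cases h1 : ‖x‖ < r <;> by_cases h2 : r < 1 <;> simp only [h1, h2, and_true,
      and_false, if_true, if_false, mul_zero, ite_self]
    have hr : 0 < r := hxp.trans h1
    rw [if_pos hr]
    have : r ^ N = r ^ (N - 1) * r := by rw [← pow_succ, Nat.sub_add_cancel (by omega)]
    rw [this]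
    field_simp
  rw [h4, intervalIntegral.integral_const_mul, intervalIntegral.integral_deriv_eq_sub
    (fun r _ => hfd r) (hfc.intervalIntegrable _ _), hf1, hfx]
  have : N • volume.real (Metric.ball (0 : E N) 1) • (-(1 / omegaS N) * (0 - φ x)) =
      omegaS N * (-(1 / omegaS N) * (0 - φ x)) := by
    rw [omegaS]; simp [Measure.real, mul_assoc]
  rw [this]
  field_simp
  ring

instance isFiniteMeasure_restrict_ball (N : ℕ) :
    IsFiniteMeasure (volume.restrict (Metric.ball (0 : E N) 1)) :=
  ⟨by simpa using measure_ball_lt_top⟩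

theorem IsTestFun.continuous_gradient {N : ℕ} {φ : E N → ℝ} (hφ : IsTestFun N φ) :
    Continuous (gradient φ) :=
  (InnerProductSpace.toDual ℝ (E N)).symm.continuous.comp (hφ.1.continuous_fderiv (by simp))

theorem IsTestFun.hasCompactSupport_gradient {N : ℕ} {φ : E N → ℝ} (hφ : IsTestFun N φ) :
    HasCompactSupport (gradient φ) :=
  (hφ.2.1.fderiv (𝕜 := ℝ)).comp_left (g := (InnerProductSpace.toDual ℝ (E N)).symm) (map_zero _)

theorem MemW.memLp_gradient {N : ℕ} {v : E N → ℝ} {G : E N → E N} (h : MemW N v G) :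
    MemLp G 2 (volume.restrict (Metric.ball (0 : E N) 1)) := by
  obtain ⟨φ, hφ, hG, -, hGlim, -⟩ := h
  have hgm : ∀ k, AEStronglyMeasurable (gradient (φ k))
      (volume.restrict (Metric.ball (0 : E N) 1)) :=
    fun k => (hφ k).1.continuous_gradient.aestronglyMeasurable
  have hm : AEStronglyMeasurable G (volume.restrict (Metric.ball (0 : E N) 1)) := by
    obtain ⟨ns, -, hns⟩ := exists_seq_tendsto_ae_of_integral_tendsto_zero
      (fun k x => sq_nonneg ‖gradient (φ k) x - G x‖) hG hGlim
    refine aestronglyMeasurable_of_tendsto_ae atTop (fun k => hgm (ns k)) ?_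
    filter_upwards [hns] with x hx
    rw [tendsto_iff_norm_sub_tendsto_zero]
    have := (Real.continuous_sqrt.tendsto 0).comp hx
    simpa [Function.comp_def, Real.sqrt_sq (norm_nonneg _)] using this
  have h1 : MemLp (gradient (φ 0)) 2 (volume.restrict (Metric.ball (0 : E N) 1)) :=
    ((hφ 0).1.continuous_gradient.memLp_of_hasCompactSupport
      (hφ 0).1.hasCompactSupport_gradient).restrict _
  have h2 : MemLp (fun x => gradient (φ 0) x - G x) 2
      (volume.restrict (Metric.ball (0 : E N) 1)) :=
    (memLp_two_iff_integrable_sq_norm ((hgm 0).sub hm)).2 (hG 0)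
  have := h1.sub h2
  refine this.ae_eq (Eventually.of_forall fun x => ?_)
  simp

theorem ae_norm_lt_one (N : ℕ) :
    ∀ᵐ y ∂(volume.restrict (Metric.ball (0 : E N) 1)), ‖y‖ < 1 := by
  filter_upwards [ae_restrict_mem Metric.isOpen_ball.measurableSet] with y hy
  simpa using hy

theorem integrable_kernelGrad_inner {N : ℕ} (hN : 3 ≤ N) {r : ℝ} (hr : 0 < r) {G : E N → E N}
    (hG : Integrable G (volume.restrict (Metric.ball (0 : E N) 1))) :
    Integrable (fun y => ⟪kernelGrad N r y, G y⟫)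
      (volume.restrict (Metric.ball (0 : E N) 1)) := by
  refine (hG.norm.const_mul (1 / omegaS N * (r ^ N)⁻¹)).mono'
    ((measurable_kernelGrad N r).aestronglyMeasurable.inner hG.1) ?_
  filter_upwards [ae_norm_lt_one N] with y hy
  exact (norm_inner_le_norm _ _).trans
    (mul_le_mul_of_nonneg_right (norm_kernelGrad_le hN hr le_rfl hy) (norm_nonneg _))

theorem abs_integral_kernelGrad_inner_le {N : ℕ} (hN : 3 ≤ N) {r : ℝ} (hr : 0 < r)
    {G : E N → E N}
    (hG : Integrable (fun x => ‖G x‖ ^ 2) (volume.restrict (Metric.ball (0 : E N) 1))) :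
    |∫ y in Metric.ball (0 : E N) 1, ⟪kernelGrad N r y, G y⟫| ≤
      1 / omegaS N * (r ^ N)⁻¹ *
        √((volume.restrict (Metric.ball (0 : E N) 1)).real univ) *
        √(∫ x in Metric.ball (0 : E N) 1, ‖G x‖ ^ 2) := by
  have hω := omegaS_pos hN
  obtain ⟨hi, hle⟩ := integrable_and_integral_le_of_sq (fun x => norm_nonneg (G x)) hG
  have h1 : |∫ y in Metric.ball (0 : E N) 1, ⟪kernelGrad N r y, G y⟫| ≤
      ∫ y in Metric.ball (0 : E N) 1, 1 / omegaS N * (r ^ N)⁻¹ * ‖G y‖ := by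
    rw [← Real.norm_eq_abs]
    refine norm_integral_le_of_norm_le (hi.const_mul _) ?_
    filter_upwards [ae_norm_lt_one N] with y hy
    exact (norm_inner_le_norm _ _).trans
      (mul_le_mul_of_nonneg_right (norm_kernelGrad_le hN hr le_rfl hy) (norm_nonneg _))
  rw [integral_const_mul] at h1
  refine h1.trans ?_
  rw [mul_assoc (1 / omegaS N * (r ^ N)⁻¹)]
  gcongr

theorem continuousOn_integral_kernelGrad_inner {N : ℕ} (hN : 3 ≤ N) {G : E N → E N}
    (hG : Integrable G (volume.restrict (Metric.ball (0 : E N) 1))) :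
    ContinuousOn (fun r => ∫ y in Metric.ball (0 : E N) 1, ⟪kernelGrad N r y, G y⟫)
      (Ioi 0) := by
  have : NeZero N := ⟨by omega⟩
  intro r hr
  have hr : 0 < r := hr
  refine ContinuousAt.continuousWithinAt ?_
  refine MeasureTheory.continuousAt_of_dominated
    (bound := fun y => 1 / omegaS N * ((r / 2) ^ N)⁻¹ * ‖G y‖) ?_ ?_ (hG.norm.const_mul _) ?_
  · exact Eventually.of_forall fun s =>
      (measurable_kernelGrad N s).aestronglyMeasurable.inner hG.1
  · filter_upwards [Ioi_mem_nhds (half_lt_self hr)] with s hs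
    filter_upwards [ae_norm_lt_one N] with y hy
    exact (norm_inner_le_norm _ _).trans
      (mul_le_mul_of_nonneg_right (norm_kernelGrad_le hN (half_pos hr) (le_of_lt hs) hy)
        (norm_nonneg _))
  · filter_upwards [ae_restrict_of_ae (ae_norm_ne N r)] with y hy
    have : (fun s => ⟪kernelGrad N s y, G y⟫) =ᶠ[nhds r] fun _ => ⟪kernelGrad N r y, G y⟫ := by
      rcases lt_or_gt_of_ne hy with h | h
      · filter_upwards [Ioi_mem_nhds h] with s hs
        simp [kernelGrad, (show ‖y‖ < s from hs).not_gt, h.not_gt]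
      · filter_upwards [Iio_mem_nhds h] with s hs
        have hs : s < ‖y‖ := hs
        simp [kernelGrad, hs, h]
    exact continuousAt_const.congr this.symm

theorem MemHN.continuousOn {N : ℕ} {u : ℝ → ℝ} (hu : MemHN N u) : ContinuousOn u (Ioo 0 1) := by
  intro r hr
  obtain ⟨a, ha0, har⟩ := exists_between hr.1
  have ha1 : a < 1 := har.trans hr.2
  have hc : ContinuousOn (fun x => u 1 - ∫ s in x..1, deriv u s) (uIcc a 1) := by
    refine continuousOn_const.sub (intervalIntegral.continuousOn_primitive_interval_left ?_)
    rw [uIcc_of_le ha1.le, integrableOn_Icc_iff_integrableOn_Ioc]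
    exact hu.locInt a ⟨ha0, ha1⟩
  rw [uIcc_of_le ha1.le] at hc
  refine ((hc.continuousAt (Icc_mem_nhds har hr.2)).congr ?_).continuousWithinAt
  filter_upwards [Ioo_mem_nhds har hr.2] with x hx
  rw [hu.ftc x ⟨ha0.trans hx.1, hx.2.le⟩, intervalIntegral.integral_of_le hx.2.le]

theorem MemW.integral_kernelGrad_inner_eq {N : ℕ} (hN : 3 ≤ N) {v : E N → ℝ} {G : E N → E N}
    (h : MemW N v G) {u : ℝ → ℝ} (hu : MemHN N u)
    (huv : ∀ᵐ x ∂(volume.restrict (Metric.ball (0 : E N) 1)), v x = u ‖x‖)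
    {t : E N} (ht0 : t ≠ 0) (ht : ‖t‖ < 1) :
    ∫ y in Metric.ball (0 : E N) 1, ⟪kernelGrad N ‖t‖ y, G y⟫ = u ‖t‖ := by
  have hGL := h.memLp_gradient
  have hGi : Integrable G (volume.restrict (Metric.ball (0 : E N) 1)) := hGL.integrable one_le_two
  obtain ⟨φ, hφ, hG, hv, hGlim, hvlim⟩ := h
  have hpt : ∀ x : E N, x ≠ 0 → ‖x‖ < 1 → Tendsto (fun k => φ k x) atTop
      (nhds (∫ y in Metric.ball (0 : E N) 1, ⟪kernelGrad N ‖x‖ y, G y⟫)) := by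
    intro x hx0 hx
    have hxp : 0 < ‖x‖ := norm_pos_iff.2 hx0
    rw [tendsto_iff_norm_sub_tendsto_zero]
    have hb : ∀ k, ‖φ k x - ∫ y in Metric.ball (0 : E N) 1, ⟪kernelGrad N ‖x‖ y, G y⟫‖ ≤
        1 / omegaS N * (‖x‖ ^ N)⁻¹ *
        √((volume.restrict (Metric.ball (0 : E N) 1)).real univ) *
        √(∫ y in Metric.ball (0 : E N) 1, ‖gradient (φ k) y - G y‖ ^ 2) := by
      intro k
      have hgi : Integrable (gradient (φ k)) (volume.restrict (Metric.ball (0 : E N) 1)) :=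
        ((hφ k).1.continuous_gradient.integrable_of_hasCompactSupport
          (hφ k).1.hasCompactSupport_gradient).restrict
      rw [← integral_kernelGrad_inner_gradient hN (hφ k).1 (hφ k).2 hx0 hx, ← integral_sub
        (integrable_kernelGrad_inner hN hxp hgi) (integrable_kernelGrad_inner hN hxp hGi)]
      simp_rw [← inner_sub_right]
      exact abs_integral_kernelGrad_inner_le hN hxp (hG k)
    refine squeeze_zero (fun _ => norm_nonneg _) hb ?_
    have := ((Real.continuous_sqrt.tendsto 0).comp hGlim).const_mul (1 / omegaS N * (‖x‖ ^ N)⁻¹ *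
        √((volume.restrict (Metric.ball (0 : E N) 1)).real univ))
    simpa [Function.comp_def] using this
  obtain ⟨ns, hns, hae⟩ := exists_seq_tendsto_ae_of_integral_tendsto_zero
    (fun k x => sq_nonneg (φ k x - v x)) hv hvlim
  set U : Set (E N) := Metric.ball 0 1 \ {0} with hU
  have hUo : IsOpen U := Metric.isOpen_ball.sdiff isClosed_singleton
  have hUm : MapsTo (fun x : E N => ‖x‖) U (Ioo 0 1) := fun x hx =>
    ⟨norm_pos_iff.2 hx.2, by simpa using hx.1⟩
  have heq : (fun x : E N => ∫ y in Metric.ball (0 : E N) 1, ⟪kernelGrad N ‖x‖ y, G y⟫)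
      =ᵐ[volume.restrict U] fun x => u ‖x‖ := by
    filter_upwards [ae_restrict_of_ae_restrict_of_subset sdiff_subset hae,
      ae_restrict_of_ae_restrict_of_subset sdiff_subset huv,
      ae_restrict_mem hUo.measurableSet] with x hx hux hxU
    have h1 : Tendsto (fun k => φ (ns k) x) atTop (nhds (v x)) := by
      rw [tendsto_iff_norm_sub_tendsto_zero]
      have := (Real.continuous_sqrt.tendsto 0).comp hx
      simpa [Function.comp_def, Real.sqrt_sq_eq_abs] using this
    have h2 := (hpt x hxU.2 (hUm hxU).2).comp hns.tendsto_atTop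
    rw [← hux]
    exact tendsto_nhds_unique h2 h1
  refine Measure.eqOn_open_of_ae_eq heq hUo ?_ ?_ ⟨by simpa using ht, ht0⟩
  · exact (continuousOn_integral_kernelGrad_inner hN hGi).comp continuous_norm.continuousOn
      fun x hx => (hUm hx).1
  · exact hu.continuousOn.comp continuous_norm.continuousOn hUm

theorem tendsto_integral_sq_norm_sub_of_bounded {α V : Type*} [MeasurableSpace α] {μ : Measure α}
    [IsFiniteMeasure μ] [NormedAddCommGroup V] {F : ℕ → α → V} {G : α → V} {B : ℝ}
    (hF : ∀ k, AEStronglyMeasurable (F k) μ) (hB : ∀ k, ∀ᵐ x ∂μ, ‖F k x‖ ≤ B)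
    (hlim : ∀ᵐ x ∂μ, Tendsto (fun k => F k x) atTop (nhds (G x))) :
    (∀ k, Integrable (fun x => ‖F k x - G x‖ ^ 2) μ) ∧
      Tendsto (fun k => ∫ x, ‖F k x - G x‖ ^ 2 ∂μ) atTop (nhds 0) := by
  have hG : AEStronglyMeasurable G μ := aestronglyMeasurable_of_tendsto_ae atTop hF hlim
  have hm : ∀ k, AEStronglyMeasurable (fun x => ‖F k x - G x‖ ^ 2) μ :=
    fun k => ((hF k).sub hG).norm.pow 2
  have hbound : ∀ k, ∀ᵐ x ∂μ, ‖‖F k x - G x‖ ^ 2‖ ≤ (B + B) ^ 2 := by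
    intro k
    filter_upwards [ae_all_iff.2 hB, hlim] with x hx hl
    have h1 : ‖G x‖ ≤ B := le_of_tendsto' hl.norm hx
    have h2 := norm_sub_le (F k x) (G x)
    have h3 := hx k
    rw [norm_pow, norm_norm]
    exact pow_le_pow_left₀ (norm_nonneg _) (by linarith) 2
  refine ⟨fun k => (integrable_const _).mono' (hm k) (hbound k), ?_⟩
  have := tendsto_integral_of_dominated_convergence (fun _ => (B + B) ^ 2) hm
    (integrable_const _) hbound (f := fun _ => 0) ?_
  · simpa using this
  · filter_upwards [hlim] with x hx
    have := (tendsto_iff_norm_sub_tendsto_zero.1 hx).pow 2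
    simpa using this

/-- A smooth cutoff with values in `[0, 1]`, vanishing on `(-∞, t]` and on `[1 - 1/(k+1), ∞)`,
which converges pointwise to `1` on `(t, 1)` as `k → ∞`. -/
noncomputable def annulusCutoff (t : ℝ) (k : ℕ) (s : ℝ) : ℝ :=
  Real.smoothTransition ((k + 1) * (s - t)) * Real.smoothTransition ((k + 1) * (1 - s) - 1)

theorem annulusCutoff_nonneg (t : ℝ) (k : ℕ) (s : ℝ) : 0 ≤ annulusCutoff t k s :=
  mul_nonneg (Real.smoothTransition.nonneg _) (Real.smoothTransition.nonneg _)

theorem annulusCutoff_le_one (t : ℝ) (k : ℕ) (s : ℝ) : annulusCutoff t k s ≤ 1 :=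
  mul_le_one₀ (Real.smoothTransition.le_one _) (Real.smoothTransition.nonneg _)
    (Real.smoothTransition.le_one _)

theorem annulusCutoff_of_le {t s : ℝ} (k : ℕ) (h : s ≤ t) : annulusCutoff t k s = 0 := by
  rw [annulusCutoff, Real.smoothTransition.zero_of_nonpos, zero_mul]
  exact mul_nonpos_of_nonneg_of_nonpos (by positivity) (by linarith)

theorem annulusCutoff_of_ge {t s : ℝ} {k : ℕ} (h : 1 - 1 / ((k : ℝ) + 1) ≤ s) :
    annulusCutoff t k s = 0 := by
  rw [annulusCutoff, Real.smoothTransition.zero_of_nonpos (x := (k + 1) * (1 - s) - 1), mul_zero]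
  have hk : (0 : ℝ) < k + 1 := by positivity
  have : ((k : ℝ) + 1) * (1 - s) ≤ (k + 1) * (1 / (k + 1)) := by gcongr; linarith
  rw [mul_one_div_cancel hk.ne'] at this
  linarith

theorem contDiff_annulusCutoff (t : ℝ) (k : ℕ) : ContDiff ℝ (⊤ : ℕ∞) (annulusCutoff t k) := by
  unfold annulusCutoff
  refine ContDiff.mul (Real.smoothTransition.contDiff.comp ?_)
    (Real.smoothTransition.contDiff.comp ?_) <;> fun_prop

theorem tendsto_annulusCutoff {t s : ℝ} (h1 : t < s) (h2 : s < 1) :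
    Tendsto (fun k => annulusCutoff t k s) atTop (nhds 1) := by
  have hk : Tendsto (fun k : ℕ => (k : ℝ) + 1) atTop atTop :=
    tendsto_natCast_atTop_atTop.atTop_add tendsto_const_nhds
  refine tendsto_const_nhds.congr' ?_
  filter_upwards [(hk.atTop_mul_const (sub_pos.2 h1)).eventually_ge_atTop 1,
    (hk.atTop_mul_const (sub_pos.2 h2)).eventually_ge_atTop 2] with k hk1 hk2
  rw [annulusCutoff, Real.smoothTransition.one_of_one_le hk1,
    Real.smoothTransition.one_of_one_le (by linarith), one_mul]

/-- A smooth approximation of minus the derivative of `gammaTMN N t`. -/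
noncomputable def slopeApprox (N : ℕ) (t : ℝ) (k : ℕ) (s : ℝ) : ℝ :=
  annulusCutoff t k s * (1 / omegaS N * (s ^ N)⁻¹) * s

theorem slopeApprox_eq_zero {N : ℕ} {t : ℝ} {k : ℕ} {s : ℝ} (h : annulusCutoff t k s = 0) :
    slopeApprox N t k s = 0 := by
  simp [slopeApprox, h]

theorem one_sub_one_div_lt (k : ℕ) : 1 - 1 / ((k : ℝ) + 1) < 1 := by
  have : (0 : ℝ) < 1 / ((k : ℝ) + 1) := by positivity
  linarith

theorem abs_slopeApprox_le {N : ℕ} (hN : 3 ≤ N) {t : ℝ} (ht : 0 < t) (k : ℕ) (s : ℝ) :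
    |slopeApprox N t k s| ≤ 1 / omegaS N * (t ^ N)⁻¹ := by
  have hω := omegaS_pos hN
  rcases le_or_gt s t with h | h
  · rw [slopeApprox_eq_zero (annulusCutoff_of_le k h), abs_zero]; positivity
  rcases le_or_gt 1 s with h1 | h1
  · rw [slopeApprox_eq_zero (annulusCutoff_of_ge ((one_sub_one_div_lt k).le.trans h1)), abs_zero]
    positivity
  have hs : 0 < s := ht.trans h
  have h0 := annulusCutoff_nonneg t k s
  rw [slopeApprox, abs_of_nonneg (by positivity)]
  have h2 : (s ^ N)⁻¹ ≤ (t ^ N)⁻¹ := by gcongr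
  calc annulusCutoff t k s * (1 / omegaS N * (s ^ N)⁻¹) * s
      ≤ 1 * (1 / omegaS N * (t ^ N)⁻¹) * 1 := by
        gcongr
        exact annulusCutoff_le_one t k s
    _ = _ := by ring

theorem contDiff_slopeApprox (N : ℕ) {t : ℝ} (ht : 0 < t) (k : ℕ) :
    ContDiff ℝ (⊤ : ℕ∞) (slopeApprox N t k) := by
  rw [contDiff_iff_contDiffAt]
  intro s
  rcases lt_or_ge s t with h | h
  · have : slopeApprox N t k =ᶠ[nhds s] fun _ => 0 := by
      filter_upwards [Iio_mem_nhds h] with r hr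
      exact slopeApprox_eq_zero (annulusCutoff_of_le k (le_of_lt hr))
    exact contDiffAt_const.congr_of_eventuallyEq this
  · have hs : s ≠ 0 := (ht.trans_le h).ne'
    unfold slopeApprox
    exact (((contDiff_annulusCutoff t k).contDiffAt).mul
      (contDiffAt_const.mul ((contDiffAt_id.pow N).inv (pow_ne_zero N hs)))).mul contDiffAt_id

/-- A smooth approximation of `gammaTMN N t`. -/
noncomputable def gammaApprox (N : ℕ) (t : ℝ) (k : ℕ) (r : ℝ) : ℝ :=
  ∫ s in r..1, slopeApprox N t k s

theorem hasDerivAt_gammaApprox (N : ℕ) {t : ℝ} (ht : 0 < t) (k : ℕ) (r : ℝ) :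
    HasDerivAt (gammaApprox N t k) (-slopeApprox N t k r) r := by
  have hc := (contDiff_slopeApprox N ht k).continuous
  exact intervalIntegral.integral_hasDerivAt_left (hc.intervalIntegrable _ _)
    (hc.stronglyMeasurableAtFilter _ _) hc.continuousAt

theorem contDiff_gammaApprox (N : ℕ) {t : ℝ} (ht : 0 < t) (k : ℕ) :
    ContDiff ℝ (⊤ : ℕ∞) (gammaApprox N t k) := by
  rw [contDiff_infty_iff_deriv]
  refine ⟨fun r => (hasDerivAt_gammaApprox N ht k r).differentiableAt, ?_⟩
  have : deriv (gammaApprox N t k) = fun r => -slopeApprox N t k r :=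
    funext fun r => (hasDerivAt_gammaApprox N ht k r).deriv
  rw [this]
  exact (contDiff_slopeApprox N ht k).neg

theorem gammaApprox_of_ge {N : ℕ} {t : ℝ} {k : ℕ} {r : ℝ} (h : 1 - 1 / ((k : ℝ) + 1) ≤ r) :
    gammaApprox N t k r = 0 := by
  refine intervalIntegral.integral_zero_ae (Eventually.of_forall fun s hs => ?_)
  refine slopeApprox_eq_zero (annulusCutoff_of_ge ?_)
  rw [uIoc, mem_Ioc] at hs
  exact (le_min h (one_sub_one_div_lt k).le).trans hs.1.le

theorem gammaApprox_of_le {N : ℕ} {t : ℝ} (ht : 0 < t) {k : ℕ} {r : ℝ} (h : r ≤ t) :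
    gammaApprox N t k r = gammaApprox N t k t := by
  have hc := (contDiff_slopeApprox N ht k).continuous
  have h0 : ∫ s in r..t, slopeApprox N t k s = 0 := by
    refine intervalIntegral.integral_zero_ae (Eventually.of_forall fun s hs => ?_)
    rw [uIoc_of_le h] at hs
    exact slopeApprox_eq_zero (annulusCutoff_of_le k hs.2)
  rw [gammaApprox, ← intervalIntegral.integral_add_adjacent_intervals
    (hc.intervalIntegrable r t) (hc.intervalIntegrable t 1), h0, zero_add, gammaApprox]

theorem abs_gammaApprox_le {N : ℕ} (hN : 3 ≤ N) {t : ℝ} (ht : 0 < t) (k : ℕ) {r : ℝ}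
    (hr0 : 0 ≤ r) (hr1 : r ≤ 1) : |gammaApprox N t k r| ≤ 1 / omegaS N * (t ^ N)⁻¹ := by
  have hω := omegaS_pos hN
  have h := intervalIntegral.norm_integral_le_of_norm_le_const (a := r) (b := 1)
    (f := slopeApprox N t k) (C := 1 / omegaS N * (t ^ N)⁻¹) (fun s _ => abs_slopeApprox_le hN ht k s)
  refine h.trans (mul_le_of_le_one_right (by positivity) ?_)
  rw [abs_le]
  constructor <;> linarith

theorem tendsto_slopeApprox {N : ℕ} {t s : ℝ} (hs : s < 1) :
    Tendsto (fun k => slopeApprox N t k s) atTop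
      (nhds (if t < s then 1 / omegaS N * (s ^ N)⁻¹ * s else 0)) := by
  split_ifs with h
  · simpa [slopeApprox] using ((tendsto_annulusCutoff h hs).mul_const _).mul_const s
  · simp [slopeApprox_eq_zero (annulusCutoff_of_le _ (not_lt.1 h))]

theorem integral_slope_eq_gammaTMN {N : ℕ} (hN : 3 ≤ N) {t r : ℝ} (ht : 0 < t) (ht1 : t < 1)
    (hr : 0 < r) (hr1 : r < 1) :
    ∫ s in r..1, (if t < s then 1 / omegaS N * (s ^ N)⁻¹ * s else 0) = gammaTMN N t r := by
  have hω := omegaS_pos hN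
  have hm : 0 < max r t := lt_max_of_lt_left hr
  have hm1 : max r t < 1 := max_lt hr1 ht1
  have hN' : (2 : ℝ) - N ≠ 0 := by
    have : (3 : ℝ) ≤ N := by exact_mod_cast hN
    linarith
  have h1 : ∫ s in r..1, (if t < s then 1 / omegaS N * (s ^ N)⁻¹ * s else 0) =
      ∫ s in max r t..1, 1 / omegaS N * s ^ ((1 : ℤ) - N) := by
    rw [intervalIntegral.integral_of_le hr1.le, intervalIntegral.integral_of_le hm1.le,
      ← integral_indicator measurableSet_Ioc, ← integral_indicator measurableSet_Ioc]
    congr 1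
    funext s
    by_cases hs : s ∈ Ioc (max r t) 1
    · have hrs : r < s := (le_max_left r t).trans_lt hs.1
      have hts : t < s := (le_max_right r t).trans_lt hs.1
      rw [indicator_of_mem hs, indicator_of_mem (show s ∈ Ioc r 1 from ⟨hrs, hs.2⟩), if_pos hts,
        sub_eq_add_neg, zpow_add₀ (hr.trans hrs).ne', zpow_neg, zpow_natCast, zpow_one]
      ring
    · rw [indicator_of_notMem hs]
      by_cases hs2 : s ∈ Ioc r 1
      · rw [indicator_of_mem hs2, if_neg]
        exact fun h => hs ⟨max_lt hs2.1 h, hs2.2⟩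
      · rw [indicator_of_notMem hs2]
  have h0 : (0 : ℝ) ∉ uIcc (max r t) 1 := by
    rw [uIcc_of_le hm1.le]
    exact fun h => hm.not_ge h.1
  rw [h1, intervalIntegral.integral_const_mul, integral_zpow (Or.inr ⟨by omega, h0⟩), one_zpow,
    gammaTMN_eq_max hN ht hr, show (1 : ℤ) - N + 1 = 2 - N by ring]
  have hN2 : (N : ℝ) - 2 ≠ 0 := by
    intro h
    exact hN' (by linarith)
  push_cast
  rw [show (1 : ℝ) - N + 1 = -(N - 2) by ring]
  field_simp
  ring

theorem tendsto_gammaApprox {N : ℕ} (hN : 3 ≤ N) {t r : ℝ} (ht : 0 < t) (ht1 : t < 1)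
    (hr : 0 < r) (hr1 : r < 1) :
    Tendsto (fun k => gammaApprox N t k r) atTop (nhds (gammaTMN N t r)) := by
  rw [← integral_slope_eq_gammaTMN hN ht ht1 hr hr1]
  refine intervalIntegral.tendsto_integral_filter_of_dominated_convergence
    (fun _ => 1 / omegaS N * (t ^ N)⁻¹) ?_ ?_ intervalIntegrable_const ?_
  · exact Eventually.of_forall fun k => (contDiff_slopeApprox N ht k).continuous.aestronglyMeasurable
  · exact Eventually.of_forall fun k => Eventually.of_forall fun s _ => abs_slopeApprox_le hN ht k s
  · filter_upwards [Measure.ae_ne volume (1 : ℝ)] with s hs hs2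
    rw [uIoc_of_le hr1.le] at hs2
    exact tendsto_slopeApprox (lt_of_le_of_ne hs2.2 hs)

theorem gammaApprox_norm_eventuallyEq {N : ℕ} {t : ℝ} (ht : 0 < t) (k : ℕ) :
    (fun x : E N => gammaApprox N t k ‖x‖) =ᶠ[nhds 0] fun _ => gammaApprox N t k t := by
  filter_upwards [Metric.ball_mem_nhds (0 : E N) ht] with x hx
  exact gammaApprox_of_le ht (by simpa using (Metric.mem_ball.1 hx).le)

theorem isTestFun_gammaApprox (N : ℕ) {t : ℝ} (ht : 0 < t) (k : ℕ) :
    IsTestFun N (fun x => gammaApprox N t k ‖x‖) := by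
  have hsub : Function.support (fun x : E N => gammaApprox N t k ‖x‖) ⊆
      Metric.closedBall 0 (1 - 1 / ((k : ℝ) + 1)) := by
    intro x hx
    rw [mem_closedBall_zero_iff]
    by_contra h
    exact hx (gammaApprox_of_ge (not_le.1 h).le)
  refine ⟨?_, HasCompactSupport.of_support_subset_isCompact (isCompact_closedBall _ _) hsub,
    (closure_minimal hsub Metric.isClosed_closedBall).trans
      (Metric.closedBall_subset_ball (one_sub_one_div_lt k))⟩
  rw [contDiff_iff_contDiffAt]
  intro x
  by_cases hx : x = 0
  · subst hx
    exact contDiffAt_const.congr_of_eventuallyEq (gammaApprox_norm_eventuallyEq ht k)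
  · exact (contDiff_gammaApprox N ht k).contDiffAt.comp x (contDiffAt_norm ℝ hx)

theorem gradient_gammaApprox (N : ℕ) {t : ℝ} (ht : 0 < t) (k : ℕ) (x : E N) :
    gradient (fun x : E N => gammaApprox N t k ‖x‖) x =
      annulusCutoff t k ‖x‖ • (-(1 / omegaS N) * (‖x‖ ^ N)⁻¹) • x := by
  by_cases hx : x = 0
  · subst hx
    rw [(gammaApprox_norm_eventuallyEq ht k).gradient_eq, gradient_fun_const]
    simp
  have hxn : ‖x‖ ≠ 0 := norm_ne_zero_iff.2 hx
  have h1 : HasFDerivAt (fun y : E N => ‖y‖) (‖x‖⁻¹ • innerSL ℝ x) x := by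
    have := (hasStrictFDerivAt_norm_sq x).hasFDerivAt.sqrt (pow_ne_zero 2 hxn)
    simp only [Real.sqrt_sq (norm_nonneg _)] at this
    refine this.congr_fderiv ?_
    ext y
    simp only [smul_apply, innerSL_apply_apply, smul_eq_mul, nsmul_eq_mul,
      Nat.cast_ofNat]
    field_simp
  have h2 := (hasDerivAt_gammaApprox N ht k ‖x‖).comp_hasFDerivAt x h1
  refine HasGradientAt.gradient (hasGradientAt_iff_hasFDerivAt.2 ?_)
  refine h2.congr_fderiv ?_
  ext y
  simp only [smul_apply, innerSL_apply_apply, smul_eq_mul, slopeApprox,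
    InnerProductSpace.toDual_apply_apply, inner_smul_left, conj_trivial]
  field_simp

theorem memW_gammaTMN {N : ℕ} (hN : 3 ≤ N) {t : ℝ} (ht : 0 < t) (ht1 : t < 1) :
    MemW N (fun x => gammaTMN N t ‖x‖) (fun x => (deriv (gammaTMN N t) ‖x‖ / ‖x‖) • x) := by
  have : NeZero N := ⟨by omega⟩
  have hω := omegaS_pos hN
  have hgrad := tendsto_integral_sq_norm_sub_of_bounded
    (μ := volume.restrict (Metric.ball (0 : E N) 1))
    (F := fun k => gradient (fun x : E N => gammaApprox N t k ‖x‖))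
    (G := fun x => (deriv (gammaTMN N t) ‖x‖ / ‖x‖) • x) (B := 1 / omegaS N * (t ^ N)⁻¹)
    (fun k => (isTestFun_gammaApprox N ht k).continuous_gradient.aestronglyMeasurable)
    (fun k => by
      refine Eventually.of_forall fun x => ?_
      refine le_trans (le_of_eq ?_) (abs_slopeApprox_le hN ht k ‖x‖)
      rw [gradient_gammaApprox N ht, smul_smul, norm_smul, slopeApprox, abs_mul, abs_norm,
        Real.norm_eq_abs, neg_mul, mul_neg, abs_neg])
    (by
      filter_upwards [ae_norm_lt_one N, ae_restrict_of_ae (gradient_gamma_ae_eq hN ht)]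
        with x hx hxe
      rw [hxe]
      simp_rw [gradient_gammaApprox N ht]
      unfold kernelGrad
      split_ifs with h
      · simpa using (tendsto_annulusCutoff h hx).smul_const
          ((-(1 / omegaS N) * (‖x‖ ^ N)⁻¹) • x)
      · simp [annulusCutoff_of_le _ (not_lt.1 h)])
  have hval := tendsto_integral_sq_norm_sub_of_bounded
    (μ := volume.restrict (Metric.ball (0 : E N) 1))
    (F := fun k (x : E N) => gammaApprox N t k ‖x‖)
    (G := fun x => gammaTMN N t ‖x‖) (B := 1 / omegaS N * (t ^ N)⁻¹)
    (fun k => (isTestFun_gammaApprox N ht k).1.continuous.aestronglyMeasurable)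
    (fun k => by
      filter_upwards [ae_norm_lt_one N] with x hx
      exact abs_gammaApprox_le hN ht k (norm_nonneg _) hx.le)
    (by
      filter_upwards [ae_norm_lt_one N, ae_restrict_of_ae (ae_norm_ne N 0)] with x hx hx0
      exact tendsto_gammaApprox hN ht ht1 (lt_of_le_of_ne (norm_nonneg _) (Ne.symm hx0)) hx)
  simp only [Real.norm_eq_abs, sq_abs] at hval
  exact ⟨fun k x => gammaApprox N t k ‖x‖, fun k => ⟨isTestFun_gammaApprox N ht k,
    fun x y hxy => congrArg (gammaApprox N t k) hxy⟩, hgrad.1, hval.1, hgrad.2, hval.2⟩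

/-- Let `N ≥ 3`. For every `t ∈ B_N` with `t ≠ 0`, the function
`k_t(x) = γ_{|t|,N}(|x|)` belongs to `W^{1,2}_{0,r}(B_N)` (with weak gradient
`γ_{|t|,N}'(|x|)·x/|x|`) and is the reproducing kernel for the point `t`: for every
`v ∈ W^{1,2}_{0,r}(B_N)` with locally absolutely continuous radial representative
`u ∈ H_N` (so `v(x) = u(|x|)` a.e.), `∫_{B_N} ∇k_t · ∇v dx = u(|t|)`. In particular the
evaluation functional `v ↦ u(|t|)` is a bounded linear functional on `W^{1,2}_{0,r}(B_N)`. -/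
theorem kernel_reproduces_W_HN (N : ℕ) (hN : 3 ≤ N)
    (t : E N) (ht : t ∈ Metric.ball (0 : E N) 1) (ht0 : t ≠ 0) :
    MemW N (fun x => gammaTMN N ‖t‖ ‖x‖)
      (fun x => (deriv (gammaTMN N ‖t‖) ‖x‖ / ‖x‖) • x) ∧
    (∀ (v : E N → ℝ) (G : E N → E N), MemW N v G →
      ∀ u : ℝ → ℝ, MemHN N u →
        (∀ᵐ x ∂(volume.restrict (Metric.ball (0 : E N) 1)), v x = u ‖x‖) →
        ∫ x in Metric.ball (0 : E N) 1,
          ⟪(deriv (gammaTMN N ‖t‖) ‖x‖ / ‖x‖) • x, G x⟫ = u ‖t‖) ∧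
    -- boundedness of the evaluation functional
    ∃ C : ℝ, ∀ (v : E N → ℝ) (G : E N → E N), MemW N v G →
      ∀ u : ℝ → ℝ, MemHN N u →
        (∀ᵐ x ∂(volume.restrict (Metric.ball (0 : E N) 1)), v x = u ‖x‖) →
        |u ‖t‖| ≤ C * Real.sqrt (∫ x in Metric.ball (0 : E N) 1, ‖G x‖^2) := by
  have ht1 : ‖t‖ < 1 := by simpa using ht
  have htp : 0 < ‖t‖ := norm_pos_iff.2 ht0
  refine ⟨memW_gammaTMN hN htp ht1, fun v G h u hu huv => ?_,
    1 / omegaS N * (‖t‖ ^ N)⁻¹ * √((volume.restrict (Metric.ball (0 : E N) 1)).real univ),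
    fun v G h u hu huv => ?_⟩
  · rw [← h.integral_kernelGrad_inner_eq hN hu huv ht0 ht1]
    refine integral_congr_ae ?_
    filter_upwards [ae_restrict_of_ae (gradient_gamma_ae_eq hN htp)] with x hx
    rw [hx]
  · rw [← h.integral_kernelGrad_inner_eq hN hu huv ht0 ht1]
    exact abs_integral_kernelGrad_inner_le hN htp
      ((memLp_two_iff_integrable_sq_norm h.memLp_gradient.1).1 h.memLp_gradient)
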